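/- arXiv:2605.21724 — 5 statements merged into one kernel-verified Lean document; each statement's English description precedes it below -/
import Mathlib

section
/- Let n, m ≥ 2 and let r ∈ ℝ^n, c ∈ ℝ^m have strictly positive entries and equal total sums. The TBP map Φ : ℝ^{(n−1)×(m−1)} → ℝ^{n×m}, sending a parameter array t to the matrix produced by the TBP (North-West corner) construction, is a bijection from ℝ^{(n−1)×(m−1)} onto the set {X ∈ T(r,c) : every entry of X is strictly positive} (the relative interior of the transportation polytope T(r,c)). -/
/-- The logistic sigmoid `σ(x) = 1 / (1 + e^{-x})`. -/
noncomputable def sigmoid (x : ℝ) : ℝ := 1 / (1 + Real.exp (-x))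

/-- Entries of the matrix produced by the TBP (North-West corner) construction,
with `ℕ`-indexed margins `r`, `c` and parameters `t`.  Positions `(i,j)` with
`i < n-1`, `j < m-1` get `L + (U - L) · σ(t i j)` where `L`, `U` are computed from
the current remaining budgets; the last column of each row gets the remaining row
budget, and the last row gets the remaining column budgets. -/
noncomputable def tbpEntry (n m : ℕ) (r c : ℕ → ℝ) (t : ℕ → ℕ → ℝ) : ℕ → ℕ → ℝ
  | i, j =>
    if i = n - 1 then
      -- the last row is filled with the remaining column budgets
      c j - ∑ k ∈ (Finset.range i).attach, tbpEntry n m r c t k.1 j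
    else if j = m - 1 then
      -- the last entry of each row is the remaining row budget
      r i - ∑ k ∈ (Finset.range j).attach, tbpEntry n m r c t i k.1
    else
      let rowB := r i - ∑ k ∈ (Finset.range j).attach, tbpEntry n m r c t i k.1
      let colB := c j - ∑ k ∈ (Finset.range i).attach, tbpEntry n m r c t k.1 j
      let colTail := ∑ k ∈ Finset.Ico (j + 1) m,
        (c k - ∑ l ∈ (Finset.range i).attach, tbpEntry n m r c t l.1 k)
      let rowTail := ∑ k ∈ Finset.Ico (i + 1) n, r k
      let L := max 0 (max (rowB - colTail) (colB - rowTail))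
      let U := min rowB colB
      L + (U - L) * sigmoid (t i j)
termination_by i j => (i, j)
decreasing_by
  all_goals
    first
    | exact Prod.Lex.left _ _ (Finset.mem_range.mp k.2)
    | exact Prod.Lex.right _ (Finset.mem_range.mp k.2)
    | exact Prod.Lex.left _ _ (Finset.mem_range.mp l.2)

/-- Extend a `Fin n`-indexed vector to `ℕ` by zero. -/
def extFin {n : ℕ} (r : Fin n → ℝ) : ℕ → ℝ :=
  fun i => if h : i < n then r ⟨i, h⟩ else 0

/-- Extend a doubly `Fin`-indexed array to `ℕ × ℕ` by zero. -/
def extFin2 {n m : ℕ} (t : Fin n → Fin m → ℝ) : ℕ → ℕ → ℝ :=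
  fun i j => if h : i < n then (if h' : j < m then t ⟨i, h⟩ ⟨j, h'⟩ else 0) else 0

/-- The transportation polytope `T(r,c)`: real `n × m` matrices with nonnegative
entries, row sums `r` and column sums `c`. -/
def transportPolytope (n m : ℕ) (r : Fin n → ℝ) (c : Fin m → ℝ) :
    Set (Matrix (Fin n) (Fin m) ℝ) :=
  {X | (∀ i j, 0 ≤ X i j) ∧ (∀ i, ∑ j, X i j = r i) ∧ (∀ j, ∑ i, X i j = c j)}

/-- The TBP map `Φ : ℝ^{(n-1)×(m-1)} → ℝ^{n×m}`. -/
noncomputable def tbpMap (n m : ℕ) (r : Fin n → ℝ) (c : Fin m → ℝ)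
    (t : Fin (n - 1) → Fin (m - 1) → ℝ) : Matrix (Fin n) (Fin m) ℝ :=
  Matrix.of fun i j => tbpEntry n m (extFin r) (extFin c) (extFin2 t) i j

theorem sigmoid_eq_real_sigmoid : sigmoid = Real.sigmoid := by
  funext x
  rw [sigmoid, Real.sigmoid_def, one_div]

/-- The budget left in row `i` once the entries before column `j` have been placed. -/
noncomputable def rowBudget (r : ℕ → ℝ) (x : ℕ → ℕ → ℝ) (i j : ℕ) : ℝ :=
  r i - ∑ k ∈ Finset.range j, x i k

/-- The budget left in column `j` once the entries above row `i` have been placed. -/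
noncomputable def colBudget (c : ℕ → ℝ) (x : ℕ → ℕ → ℝ) (i j : ℕ) : ℝ :=
  c j - ∑ k ∈ Finset.range i, x k j

/-- The lower bound for the entry `(i, j)` given the earlier entries of `x`. -/
noncomputable def entryLower (n m : ℕ) (r c : ℕ → ℝ) (x : ℕ → ℕ → ℝ) (i j : ℕ) : ℝ :=
  max 0 (max (rowBudget r x i j - ∑ k ∈ Finset.Ico (j + 1) m, colBudget c x i k)
    (colBudget c x i j - ∑ k ∈ Finset.Ico (i + 1) n, r k))

/-- The upper bound for the entry `(i, j)` given the earlier entries of `x`. -/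
noncomputable def entryUpper (r c : ℕ → ℝ) (x : ℕ → ℕ → ℝ) (i j : ℕ) : ℝ :=
  min (rowBudget r x i j) (colBudget c x i j)

section Recursion

variable {n m : ℕ} {r c : ℕ → ℝ} {t : ℕ → ℕ → ℝ} {i j : ℕ}

theorem tbpEntry_last_row (hi : i = n - 1) :
    tbpEntry n m r c t i j = colBudget c (tbpEntry n m r c t) i j := by
  rw [tbpEntry, if_pos hi, colBudget,
    Finset.sum_attach (Finset.range i) fun k => tbpEntry n m r c t k j]

theorem tbpEntry_last_col (hi : i ≠ n - 1) (hj : j = m - 1) :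
    tbpEntry n m r c t i j = rowBudget r (tbpEntry n m r c t) i j := by
  rw [tbpEntry, if_neg hi, if_pos hj, rowBudget,
    Finset.sum_attach (Finset.range j) fun k => tbpEntry n m r c t i k]

theorem tbpEntry_interior (hi : i ≠ n - 1) (hj : j ≠ m - 1) :
    tbpEntry n m r c t i j = entryLower n m r c (tbpEntry n m r c t) i j +
      (entryUpper r c (tbpEntry n m r c t) i j - entryLower n m r c (tbpEntry n m r c t) i j) *
        sigmoid (t i j) := by
  rw [tbpEntry, if_neg hi, if_neg hj]
  simp only [entryLower, entryUpper, rowBudget, colBudget]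
  simp only [Finset.sum_attach (Finset.range j) fun k => tbpEntry n m r c t i k,
    fun j => Finset.sum_attach (Finset.range i) fun k => tbpEntry n m r c t k j]

end Recursion

section Budgets

variable {n m : ℕ} {r c : ℕ → ℝ} {x y : ℕ → ℕ → ℝ} {i j : ℕ}

theorem rowBudget_succ : rowBudget r x i (j + 1) = rowBudget r x i j - x i j := by
  rw [rowBudget, rowBudget, Finset.sum_range_succ]; ring

theorem colBudget_succ : colBudget c x (i + 1) j = colBudget c x i j - x i j := by
  rw [colBudget, colBudget, Finset.sum_range_succ]; ring

theorem rowBudget_congr (h : ∀ k < j, x i k = y i k) :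
    rowBudget r x i j = rowBudget r y i j := by
  rw [rowBudget, rowBudget, Finset.sum_congr rfl fun k hk => h k (Finset.mem_range.mp hk)]

theorem colBudget_congr (h : ∀ k < i, x k j = y k j) :
    colBudget c x i j = colBudget c y i j := by
  rw [colBudget, colBudget, Finset.sum_congr rfl fun k hk => h k (Finset.mem_range.mp hk)]

theorem entryLower_congr (hj : j < m) (hrow : ∀ k < j, x i k = y i k)
    (hcol : ∀ l < i, ∀ k < m, x l k = y l k) :
    entryLower n m r c x i j = entryLower n m r c y i j := by
  rw [entryLower, entryLower, rowBudget_congr hrow, colBudget_congr fun l hl => hcol l hl j hj,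
    Finset.sum_congr rfl fun k hk =>
      colBudget_congr fun l hl => hcol l hl k (Finset.mem_Ico.mp hk).2]

theorem entryUpper_congr (hrow : ∀ k < j, x i k = y i k) (hcol : ∀ l < i, x l j = y l j) :
    entryUpper r c x i j = entryUpper r c y i j := by
  rw [entryUpper, entryUpper, rowBudget_congr hrow, colBudget_congr hcol]

theorem rowBudget_eq_sum_Ico (hj : j ≤ m) (h : ∑ k ∈ Finset.range m, x i k = r i) :
    rowBudget r x i j = ∑ k ∈ Finset.Ico j m, x i k := by
  rw [rowBudget, ← h, ← Finset.sum_range_add_sum_Ico _ hj]; ring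

theorem colBudget_eq_sum_Ico (hi : i ≤ n) (h : ∑ k ∈ Finset.range n, x k j = c j) :
    colBudget c x i j = ∑ k ∈ Finset.Ico i n, x k j := by
  rw [colBudget, ← h, ← Finset.sum_range_add_sum_Ico _ hi]; ring

end Budgets

section Construction

variable {n m : ℕ} {r c : ℕ → ℝ} {t : ℕ → ℕ → ℝ} {i j : ℕ}

theorem tbpEntry_mem_Ioo (hi : i ≠ n - 1) (hj : j ≠ m - 1)
    (h : entryLower n m r c (tbpEntry n m r c t) i j <
      entryUpper r c (tbpEntry n m r c t) i j) :
    tbpEntry n m r c t i j ∈ Set.Ioo (entryLower n m r c (tbpEntry n m r c t) i j)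
      (entryUpper r c (tbpEntry n m r c t) i j) := by
  have hs : 0 < sigmoid (t i j) ∧ sigmoid (t i j) < 1 := by
    rw [sigmoid_eq_real_sigmoid]
    exact ⟨Real.sigmoid_pos _, Real.sigmoid_lt_one _⟩
  rw [tbpEntry_interior hi hj]
  constructor <;> nlinarith [hs.1, hs.2]

/-- The state before row `i`: the column budgets are positive and balance the remaining rows. -/
def ColumnsReady (n m : ℕ) (r c : ℕ → ℝ) (x : ℕ → ℕ → ℝ) (i : ℕ) : Prop :=
  (∀ j < m, 0 < colBudget c x i j) ∧
    ∑ j ∈ Finset.range m, colBudget c x i j = ∑ k ∈ Finset.Ico i n, r k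

theorem entryLower_lt_entryUpper {x : ℕ → ℕ → ℝ} (hr : ∀ i < n, 0 < r i)
    (hi : i < n - 1) (hj : j < m - 1) (hC : ColumnsReady n m r c x i)
    (hrow : ∑ k ∈ Finset.range j, x i k + rowBudget r x i j = r i)
    (hpast : ∀ k < j, x i k < colBudget c x i k)
    (hR : 0 < rowBudget r x i j)
    (hRlt : rowBudget r x i j < ∑ k ∈ Finset.Ico j m, colBudget c x i k) :
    entryLower n m r c x i j < entryUpper r c x i j := by
  have hCj := hC.1 j (by omega)
  have hcolTail : 0 < ∑ k ∈ Finset.Ico (j + 1) m, colBudget c x i k :=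
    Finset.sum_pos (fun k hk => hC.1 k (Finset.mem_Ico.mp hk).2) ⟨j + 1, by simp; omega⟩
  have hrowTail : 0 < ∑ k ∈ Finset.Ico (i + 1) n, r k :=
    Finset.sum_pos (fun k hk => hr k (Finset.mem_Ico.mp hk).2) ⟨i + 1, by simp; omega⟩
  have hsplit := Finset.sum_eq_sum_Ico_succ_bot (show j < m by omega) (colBudget c x i)
  have hbal := hC.2
  rw [Finset.sum_eq_sum_Ico_succ_bot (show i < n by omega), ← hrow,
    ← Finset.sum_range_add_sum_Ico _ (show j ≤ m by omega)] at hbal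
  have hle : ∑ k ∈ Finset.range j, x i k ≤ ∑ k ∈ Finset.range j, colBudget c x i k :=
    Finset.sum_le_sum fun k hk => (hpast k (Finset.mem_range.mp hk)).le
  refine max_lt (lt_min hR hCj) (max_lt (lt_min ?_ ?_) (lt_min ?_ ?_)) <;> linarith

theorem tbpEntry_row (hr : ∀ i < n, 0 < r i) (hi : i < n - 1)
    (hC : ColumnsReady n m r c (tbpEntry n m r c t) i) (hj : j ≤ m - 1) :
    0 < rowBudget r (tbpEntry n m r c t) i j ∧
      rowBudget r (tbpEntry n m r c t) i j <
        ∑ k ∈ Finset.Ico j m, colBudget c (tbpEntry n m r c t) i k ∧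
      ∀ k < j, entryLower n m r c (tbpEntry n m r c t) i k <
          entryUpper r c (tbpEntry n m r c t) i k ∧
        0 < tbpEntry n m r c t i k ∧
        tbpEntry n m r c t i k < colBudget c (tbpEntry n m r c t) i k := by
  induction j with
  | zero =>
    refine ⟨by simpa [rowBudget] using hr i (by omega), ?_, by simp⟩
    have hrowTail : 0 < ∑ k ∈ Finset.Ico (i + 1) n, r k :=
      Finset.sum_pos (fun k hk => hr k (Finset.mem_Ico.mp hk).2) ⟨i + 1, by simp; omega⟩
    rw [← Finset.range_eq_Ico, hC.2, Finset.sum_eq_sum_Ico_succ_bot (show i < n by omega)]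
    simpa [rowBudget] using hrowTail
  | succ j ih =>
    obtain ⟨hR, hRlt, hpast⟩ := ih (by omega)
    have hlt := entryLower_lt_entryUpper hr hi hj hC (by rw [rowBudget]; ring)
      (fun k hk => (hpast k hk).2.2) hR hRlt
    obtain ⟨hlo, hup⟩ := tbpEntry_mem_Ioo hi.ne (show j ≠ m - 1 by omega) hlt
    rw [entryLower, max_lt_iff, max_lt_iff] at hlo
    rw [entryUpper, lt_min_iff] at hup
    refine ⟨by rw [rowBudget_succ]; linarith, by rw [rowBudget_succ]; linarith, fun k hk => ?_⟩
    rcases Nat.lt_succ_iff_lt_or_eq.mp hk with hk | rfl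
    · exact hpast k hk
    · exact ⟨hlt, hlo.1, hup.2⟩

theorem tbpEntry_mem_Ioo_colBudget (hm : 2 ≤ m) (hr : ∀ i < n, 0 < r i) (hi : i < n - 1)
    (hC : ColumnsReady n m r c (tbpEntry n m r c t) i) (hj : j < m) :
    tbpEntry n m r c t i j ∈ Set.Ioo 0 (colBudget c (tbpEntry n m r c t) i j) := by
  obtain ⟨hR, hRlt, hpast⟩ := tbpEntry_row hr hi hC le_rfl
  rcases (Nat.le_sub_one_of_lt hj).lt_or_eq with hj' | rfl
  · exact (hpast j hj').2
  · rw [Finset.sum_eq_sum_Ico_succ_bot hj, Nat.sub_add_cancel (by omega), Finset.Ico_self,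
      Finset.sum_empty, add_zero] at hRlt
    rw [tbpEntry_last_col hi.ne rfl]
    exact ⟨hR, hRlt⟩

theorem sum_tbpEntry_row (hm : 0 < m) (hi : i < n - 1) :
    ∑ j ∈ Finset.range m, tbpEntry n m r c t i j = r i := by
  obtain ⟨m, rfl⟩ := Nat.exists_eq_add_one.mpr hm
  rw [Finset.sum_range_succ, tbpEntry_last_col hi.ne (show m = m + 1 - 1 by omega), rowBudget]
  ring

theorem columnsReady_tbpEntry (hm : 2 ≤ m) (hr : ∀ i < n, 0 < r i) (hc : ∀ j < m, 0 < c j)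
    (hbal : ∑ i ∈ Finset.range n, r i = ∑ j ∈ Finset.range m, c j) (hi : i ≤ n - 1) :
    ColumnsReady n m r c (tbpEntry n m r c t) i := by
  induction i with
  | zero => exact ⟨by simpa [colBudget] using hc, by simp [colBudget, hbal]⟩
  | succ i ih =>
    have hC := ih (by omega)
    refine ⟨fun j hj => ?_, ?_⟩
    · rw [colBudget_succ]
      exact sub_pos.mpr (tbpEntry_mem_Ioo_colBudget hm hr hi hC hj).2
    · have h := hC.2
      rw [Finset.sum_eq_sum_Ico_succ_bot (show i < n by omega)] at h
      simp only [colBudget_succ, Finset.sum_sub_distrib]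
      rw [h, sum_tbpEntry_row (by omega) hi]
      ring

end Construction

section Inverse

variable {n m : ℕ} {r c : ℕ → ℝ} {x : ℕ → ℕ → ℝ} {i j : ℕ}

theorem mem_Ioo_entryLower_entryUpper (hx : ∀ i < n, ∀ j < m, 0 < x i j)
    (hrow : ∀ i < n, ∑ j ∈ Finset.range m, x i j = r i)
    (hcol : ∀ j < m, ∑ i ∈ Finset.range n, x i j = c j) (hi : i < n - 1) (hj : j < m - 1) :
    x i j ∈ Set.Ioo (entryLower n m r c x i j) (entryUpper r c x i j) := by
  have hrowB := rowBudget_eq_sum_Ico (show j ≤ m by omega) (hrow i (by omega))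
  have hcolB : ∀ k < m, colBudget c x i k = ∑ l ∈ Finset.Ico i n, x l k := fun k hk =>
    colBudget_eq_sum_Ico (by omega) (hcol k hk)
  have hrow_rest : 0 < ∑ k ∈ Finset.Ico (j + 1) m, x i k :=
    Finset.sum_pos (fun k hk => hx i (by omega) k (Finset.mem_Ico.mp hk).2)
      ⟨j + 1, by simp; omega⟩
  have hcol_rest : 0 < ∑ k ∈ Finset.Ico (i + 1) n, x k j :=
    Finset.sum_pos (fun k hk => hx k (Finset.mem_Ico.mp hk).2 j (by omega))
      ⟨i + 1, by simp; omega⟩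
  have hcolTail : ∑ k ∈ Finset.Ico (j + 1) m, x i k <
      ∑ k ∈ Finset.Ico (j + 1) m, colBudget c x i k := by
    refine Finset.sum_lt_sum_of_nonempty ⟨j + 1, by simp; omega⟩ fun k hk => ?_
    have hk := (Finset.mem_Ico.mp hk).2
    rw [hcolB k hk]
    exact Finset.single_lt_sum (f := fun l => x l k) (show i + 1 ≠ i by omega)
      (by simp; omega) (by simp; omega) (hx _ (by omega) _ hk)
      fun l hl _ => (hx l (Finset.mem_Ico.mp hl).2 k hk).le
  have hrowTail : ∑ l ∈ Finset.Ico (i + 1) n, x l j < ∑ l ∈ Finset.Ico (i + 1) n, r l := by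
    refine Finset.sum_lt_sum_of_nonempty ⟨i + 1, by simp; omega⟩ fun l hl => ?_
    have hl := (Finset.mem_Ico.mp hl).2
    rw [← hrow l hl]
    exact Finset.single_lt_sum (show j + 1 ≠ j by omega)
      (by simp; omega) (by simp; omega) (hx _ hl _ (by omega))
      fun k hk _ => (hx l hl k (Finset.mem_range.mp hk)).le
  rw [Finset.sum_eq_sum_Ico_succ_bot (show j < m by omega)] at hrowB
  have hcolBj := hcolB j (by omega)
  rw [Finset.sum_eq_sum_Ico_succ_bot (show i < n by omega)] at hcolBj
  exact ⟨max_lt (hx i (by omega) j (by omega)) (max_lt (by linarith) (by linarith)),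
    lt_min (by linarith) (by linarith)⟩

theorem exists_sigmoid_interpolation {a b y : ℝ} (hy : y ∈ Set.Ioo a b) :
    ∃ s, a + (b - a) * sigmoid s = y := by
  have hab : 0 < b - a := by linarith [hy.1, hy.2]
  have h : (y - a) / (b - a) ∈ Set.range Real.sigmoid := by
    rw [Real.range_sigmoid]
    exact ⟨div_pos (by linarith [hy.1]) hab, (div_lt_one hab).mpr (by linarith [hy.2])⟩
  obtain ⟨s, hs⟩ := h
  refine ⟨s, ?_⟩
  rw [sigmoid_eq_real_sigmoid, hs]
  field_simp
  ring

theorem tbpEntry_eq_of_interior {t : ℕ → ℕ → ℝ}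
    (hrow : ∀ i < n, ∑ j ∈ Finset.range m, x i j = r i)
    (hcol : ∀ j < m, ∑ i ∈ Finset.range n, x i j = c j)
    (ht : ∀ i < n - 1, ∀ j < m - 1, entryLower n m r c x i j +
      (entryUpper r c x i j - entryLower n m r c x i j) * sigmoid (t i j) = x i j) :
    ∀ i < n, ∀ j < m, tbpEntry n m r c t i j = x i j := by
  intro i
  induction i using Nat.strong_induction_on with
  | _ i ihi =>
  intro hi j
  induction j using Nat.strong_induction_on with
  | _ j ihj =>
  intro hj
  have hprev : ∀ l < i, ∀ k < m, tbpEntry n m r c t l k = x l k :=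
    fun l hl => ihi l hl (by omega)
  have hleft : ∀ k < j, tbpEntry n m r c t i k = x i k := fun k hk => ihj k hk (by omega)
  by_cases hi' : i = n - 1
  · rw [tbpEntry_last_row hi', colBudget_congr fun l hl => hprev l hl j hj,
      colBudget_eq_sum_Ico hi.le (hcol j hj), Finset.sum_eq_sum_Ico_succ_bot hi,
      Finset.Ico_eq_empty (by omega), Finset.sum_empty, add_zero]
  by_cases hj' : j = m - 1
  · rw [tbpEntry_last_col hi' hj', rowBudget_congr hleft,
      rowBudget_eq_sum_Ico hj.le (hrow i hi), Finset.sum_eq_sum_Ico_succ_bot hj,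
      Finset.Ico_eq_empty (by omega), Finset.sum_empty, add_zero]
  rw [tbpEntry_interior hi' hj', entryLower_congr hj hleft hprev,
    entryUpper_congr hleft fun l hl => hprev l hl j hj]
  exact ht i (by omega) j (by omega)

end Inverse

section Extension

variable {n m : ℕ}

theorem extFin_coe (r : Fin n → ℝ) (i : Fin n) : extFin r i = r i := by simp [extFin]

theorem extFin2_coe (t : Fin n → Fin m → ℝ) (i : Fin n) (j : Fin m) :
    extFin2 t i j = t i j := by simp [extFin2]

theorem sum_range_extFin (r : Fin n → ℝ) : ∑ i ∈ Finset.range n, extFin r i = ∑ i, r i := by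
  simp only [Finset.sum_range, extFin_coe]

theorem extFin_pos {r : Fin n → ℝ} (hr : ∀ i, 0 < r i) : ∀ i < n, 0 < extFin r i :=
  fun i hi => by simpa [extFin, hi] using hr ⟨i, hi⟩

end Extension

/-- For `n, m ≥ 2` and strictly positive margins `r, c` with equal
total sums, the TBP map is a bijection from `ℝ^{(n-1)×(m-1)}` onto the set of
matrices of `T(r,c)` all of whose entries are strictly positive (the relative
interior of the transportation polytope). -/
theorem tbp_bijection (n m : ℕ) (hn : 2 ≤ n) (hm : 2 ≤ m)
    (r : Fin n → ℝ) (c : Fin m → ℝ)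
    (hr : ∀ i, 0 < r i) (hc : ∀ j, 0 < c j)
    (hbal : ∑ i, r i = ∑ j, c j) :
    Set.BijOn (tbpMap n m r c) Set.univ
      {X : Matrix (Fin n) (Fin m) ℝ |
        X ∈ transportPolytope n m r c ∧ ∀ i j, 0 < X i j} := by
  have hr' := extFin_pos hr
  have hc' := extFin_pos hc
  have hbal' : ∑ i ∈ Finset.range n, extFin r i = ∑ j ∈ Finset.range m, extFin c j := by
    rw [sum_range_extFin, sum_range_extFin, hbal]
  have hready (t : ℕ → ℕ → ℝ) {i : ℕ} (hi : i ≤ n - 1) :=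
    columnsReady_tbpEntry (t := t) hm hr' hc' hbal' hi
  refine ⟨fun t _ => ?_, fun t _ s _ hts => ?_, fun X hX => ?_⟩
  · have hpos : ∀ i j, 0 < tbpMap n m r c t i j := by
      intro i j
      rcases (Nat.le_sub_one_of_lt i.2).lt_or_eq with hi | hi
      · exact (tbpEntry_mem_Ioo_colBudget hm hr' hi (hready _ hi.le) j.2).1
      · rw [tbpMap, Matrix.of_apply, tbpEntry_last_row hi]
        exact (hready _ hi.le).1 j j.2
    refine ⟨⟨fun i j => (hpos i j).le, fun i => ?_, fun j => ?_⟩, hpos⟩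
    · simp only [tbpMap, Matrix.of_apply]
      rw [← Finset.sum_range fun j => tbpEntry n m (extFin r) (extFin c) (extFin2 t) i j,
        ← extFin_coe r]
      rcases (Nat.le_sub_one_of_lt i.2).lt_or_eq with hi | hi
      · exact sum_tbpEntry_row (by omega) hi
      · simp only [tbpEntry_last_row hi]
        rw [(hready _ hi.le).2, Finset.sum_eq_sum_Ico_succ_bot i.2,
          Finset.Ico_eq_empty (by omega), Finset.sum_empty, add_zero]
    · simp only [tbpMap, Matrix.of_apply]
      rw [← Finset.sum_range fun i => tbpEntry n m (extFin r) (extFin c) (extFin2 t) i j,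
        ← extFin_coe c]
      obtain ⟨n, rfl⟩ := Nat.exists_eq_add_one.mpr (show 0 < n by omega)
      rw [Finset.sum_range_succ, tbpEntry_last_row (show n = n + 1 - 1 by omega), colBudget]
      ring
  · have hentry : ∀ i < n, ∀ j < m, tbpEntry n m (extFin r) (extFin c) (extFin2 t) i j =
        tbpEntry n m (extFin r) (extFin c) (extFin2 s) i j := fun i hi j hj =>
      congrFun (congrFun hts ⟨i, hi⟩) ⟨j, hj⟩
    funext i j
    have hi := i.2
    have hj := j.2
    have hlt := ((tbpEntry_row hr' hi (hready (extFin2 s) hi.le) le_rfl).2.2 j hj).1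
    have h := hentry i (by omega) j (by omega)
    rw [tbpEntry_interior hi.ne hj.ne, tbpEntry_interior hi.ne hj.ne,
      entryLower_congr (by omega) (fun k hk => hentry i (by omega) k (by omega))
        (fun l hl => hentry l (by omega)),
      entryUpper_congr (fun k hk => hentry i (by omega) k (by omega))
        (fun l hl => hentry l (by omega) j (by omega)), add_right_inj,
      mul_right_inj' (sub_pos.mpr hlt).ne', sigmoid_eq_real_sigmoid, extFin2_coe,
      extFin2_coe] at h
    exact Real.sigmoid_injective h
  · obtain ⟨⟨-, hrow, hcol⟩, hpos⟩ := hX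
    have hx : ∀ i < n, ∀ j < m, 0 < extFin2 X i j := fun i hi j hj => by
      simpa [extFin2, hi, hj] using hpos ⟨i, hi⟩ ⟨j, hj⟩
    have hrow' : ∀ i < n, ∑ j ∈ Finset.range m, extFin2 X i j = extFin r i := fun i hi => by
      simpa [Finset.sum_range, extFin2, extFin, hi] using hrow ⟨i, hi⟩
    have hcol' : ∀ j < m, ∑ i ∈ Finset.range n, extFin2 X i j = extFin c j := fun j hj => by
      simpa [Finset.sum_range, extFin2, extFin, hj] using hcol ⟨j, hj⟩
    choose t ht using fun (i : Fin (n - 1)) (j : Fin (m - 1)) =>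
      exists_sigmoid_interpolation (mem_Ioo_entryLower_entryUpper hx hrow' hcol' i.2 j.2)
    refine ⟨t, Set.mem_univ _, ?_⟩
    ext i j
    rw [tbpMap, Matrix.of_apply, ← extFin2_coe X]
    refine tbpEntry_eq_of_interior hrow' hcol' (fun i hi j hj => ?_) i i.2 j j.2
    have h := ht ⟨i, hi⟩ ⟨j, hj⟩
    rwa [← extFin2_coe t] at h
end

section
/- Let n, m ≥ 2 and let r ∈ ℝ^n, c ∈ ℝ^m have strictly positive entries and equal total sums. Every matrix X ∈ T(r,c) all of whose entries are strictly positive lies in the image of the TBP map: there exists a unique parameter array t ∈ ℝ^{(n−1)×(m−1)} with TBP(t) = X. -/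
lemma sigmoid_strictMono : StrictMono sigmoid := by
  intro a b hab
  have h : Real.exp (-b) < Real.exp (-a) := Real.exp_lt_exp.2 (by linarith)
  unfold sigmoid
  exact one_div_lt_one_div_of_lt (by positivity) (by linarith)

lemma exists_sigmoid_eq {p : ℝ} (h0 : 0 < p) (h1 : p < 1) : ∃ t, sigmoid t = p := by
  have h : 0 < (1 - p) / p := div_pos (by linarith) h0
  refine ⟨-Real.log ((1 - p) / p), ?_⟩
  rw [sigmoid, neg_neg, Real.exp_log h]
  field_simp
  ring

/-- The lower bound of the TBP construction at `(i, j)`, as a function of the earlier entries of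
`x`. -/
noncomputable def tbpLower (n m : ℕ) (r c : ℕ → ℝ) (x : ℕ → ℕ → ℝ) (i j : ℕ) : ℝ :=
  max 0 (max
    (r i - ∑ k ∈ Finset.range j, x i k -
      ∑ k ∈ Finset.Ico (j + 1) m, (c k - ∑ l ∈ Finset.range i, x l k))
    (c j - ∑ k ∈ Finset.range i, x k j - ∑ k ∈ Finset.Ico (i + 1) n, r k))

/-- The upper bound of the TBP construction at `(i, j)`, as a function of the earlier entries of
`x`. -/
noncomputable def tbpUpper (r c : ℕ → ℝ) (x : ℕ → ℕ → ℝ) (i j : ℕ) : ℝ :=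
  min (r i - ∑ k ∈ Finset.range j, x i k) (c j - ∑ k ∈ Finset.range i, x k j)

lemma tbpEntry_eq (n m : ℕ) (r c : ℕ → ℝ) (t : ℕ → ℕ → ℝ) (i j : ℕ) :
    tbpEntry n m r c t i j =
      if i = n - 1 then c j - ∑ k ∈ Finset.range i, tbpEntry n m r c t k j
      else if j = m - 1 then r i - ∑ k ∈ Finset.range j, tbpEntry n m r c t i k
      else tbpLower n m r c (tbpEntry n m r c t) i j +
        (tbpUpper r c (tbpEntry n m r c t) i j -
          tbpLower n m r c (tbpEntry n m r c t) i j) * sigmoid (t i j) := by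
  have attach_sum (f : ℕ → ℝ) (s : ℕ) :
      ∑ k ∈ (Finset.range s).attach, f k.1 = ∑ k ∈ Finset.range s, f k :=
    Finset.sum_attach _ f
  conv_lhs => rw [tbpEntry]
  have col (k : ℕ) := attach_sum (fun l => tbpEntry n m r c t l k) i
  simp only [col, attach_sum (fun k => tbpEntry n m r c t i k), tbpLower, tbpUpper]

section Congr

variable {m : ℕ} {x y : ℕ → ℕ → ℝ} {i j : ℕ}

lemma tbpLower_congr (n : ℕ) (r c : ℕ → ℝ) (hj : j < m)
    (hrows : ∀ l < i, ∀ k < m, x l k = y l k) (hrow : ∀ k < j, x i k = y i k) :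
    tbpLower n m r c x i j = tbpLower n m r c y i j := by
  have h1 : ∑ k ∈ Finset.range j, x i k = ∑ k ∈ Finset.range j, y i k :=
    Finset.sum_congr rfl fun k hk => hrow k (Finset.mem_range.1 hk)
  have h2 (k : ℕ) (hk : k < m) :
      ∑ l ∈ Finset.range i, x l k = ∑ l ∈ Finset.range i, y l k :=
    Finset.sum_congr rfl fun l hl => hrows l (Finset.mem_range.1 hl) k hk
  have h3 : ∑ k ∈ Finset.Ico (j + 1) m, (c k - ∑ l ∈ Finset.range i, x l k) =
      ∑ k ∈ Finset.Ico (j + 1) m, (c k - ∑ l ∈ Finset.range i, y l k) :=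
    Finset.sum_congr rfl fun k hk => by rw [h2 k (Finset.mem_Ico.1 hk).2]
  rw [tbpLower, tbpLower, h1, h2 j hj, h3]

lemma tbpUpper_congr (r c : ℕ → ℝ) (hj : j < m)
    (hrows : ∀ l < i, ∀ k < m, x l k = y l k) (hrow : ∀ k < j, x i k = y i k) :
    tbpUpper r c x i j = tbpUpper r c y i j := by
  have h1 : ∑ k ∈ Finset.range j, x i k = ∑ k ∈ Finset.range j, y i k :=
    Finset.sum_congr rfl fun k hk => hrow k (Finset.mem_range.1 hk)
  have h2 : ∑ l ∈ Finset.range i, x l j = ∑ l ∈ Finset.range i, y l j :=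
    Finset.sum_congr rfl fun l hl => hrows l (Finset.mem_range.1 hl) j hj
  rw [tbpUpper, tbpUpper, h1, h2]

end Congr

section Margins

variable {n m : ℕ} {r c : ℕ → ℝ} {x : ℕ → ℕ → ℝ}

lemma tbpEntry_eqOn_iff
    (hrow : ∀ i < n, ∑ k ∈ Finset.range m, x i k = r i)
    (hcol : ∀ j < m, ∑ k ∈ Finset.range n, x k j = c j) (t : ℕ → ℕ → ℝ) :
    (∀ i < n, ∀ j < m, tbpEntry n m r c t i j = x i j) ↔
      ∀ i < n - 1, ∀ j < m - 1, tbpLower n m r c x i j +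
        (tbpUpper r c x i j - tbpLower n m r c x i j) * sigmoid (t i j) = x i j := by
  constructor
  · intro h i hi j hj
    have hrows : ∀ l < i, ∀ k < m, tbpEntry n m r c t l k = x l k :=
      fun l hl => h l (by omega)
    have hprev : ∀ k < j, tbpEntry n m r c t i k = x i k :=
      fun k hk => h i (by omega) k (by omega)
    have e := tbpEntry_eq n m r c t i j
    rw [if_neg (by omega), if_neg (by omega), h i (by omega) j (by omega),
      tbpLower_congr n r c (by omega) hrows hprev,
      tbpUpper_congr r c (by omega) hrows hprev] at e
    exact e.symm
  · intro h i
    induction i using Nat.strong_induction_on with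
    | _ i ihi =>
    intro hi j
    induction j using Nat.strong_induction_on with
    | _ j ihj =>
    intro hj
    have hrows : ∀ l < i, ∀ k < m, tbpEntry n m r c t l k = x l k :=
      fun l hl => ihi l hl (by omega)
    have hprev : ∀ k < j, tbpEntry n m r c t i k = x i k :=
      fun k hk => ihj k hk (by omega)
    rw [tbpEntry_eq]
    split_ifs with hin hjm
    · rw [Finset.sum_congr rfl fun k hk => hrows k (Finset.mem_range.1 hk) j hj,
        ← hcol j hj, show n = i + 1 by omega, Finset.sum_range_succ]
      ring
    · rw [Finset.sum_congr rfl fun k hk => hprev k (Finset.mem_range.1 hk),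
        ← hrow i hi, show m = j + 1 by omega, Finset.sum_range_succ]
      ring
    · rw [tbpLower_congr n r c hj hrows hprev, tbpUpper_congr r c hj hrows hprev]
      exact h i (by omega) j (by omega)

lemma lt_tbpUpper {i j : ℕ} (hrow : ∀ i < n, ∑ k ∈ Finset.range m, x i k = r i)
    (hcol : ∀ j < m, ∑ k ∈ Finset.range n, x k j = c j)
    (hpos : ∀ i < n, ∀ j < m, 0 < x i j) (hi : i < n - 1) (hj : j < m - 1) :
    x i j < tbpUpper r c x i j := by
  have hR : 0 < ∑ k ∈ Finset.Ico (j + 1) m, x i k :=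
    Finset.sum_pos (fun k hk => hpos i (by omega) k (Finset.mem_Ico.1 hk).2)
      (Finset.nonempty_Ico.2 (by omega))
  have hC : 0 < ∑ k ∈ Finset.Ico (i + 1) n, x k j :=
    Finset.sum_pos (fun k hk => hpos k (Finset.mem_Ico.1 hk).2 j (by omega))
      (Finset.nonempty_Ico.2 (by omega))
  have hr := hrow i (by omega)
  have hc := hcol j (by omega)
  rw [← Finset.sum_range_add_sum_Ico _ (show j + 1 ≤ m by omega), Finset.sum_range_succ] at hr
  rw [← Finset.sum_range_add_sum_Ico _ (show i + 1 ≤ n by omega), Finset.sum_range_succ] at hc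
  exact lt_min (by linarith) (by linarith)

lemma tbpLower_lt {i j : ℕ} (hrow : ∀ i < n, ∑ k ∈ Finset.range m, x i k = r i)
    (hcol : ∀ j < m, ∑ k ∈ Finset.range n, x k j = c j)
    (hpos : ∀ i < n, ∀ j < m, 0 < x i j) (hi : i < n - 1) (hj : j < m - 1) :
    tbpLower n m r c x i j < x i j := by
  have hr := hrow i (by omega)
  have hc := hcol j (by omega)
  rw [← Finset.sum_range_add_sum_Ico _ (show j + 1 ≤ m by omega), Finset.sum_range_succ] at hr
  rw [← Finset.sum_range_add_sum_Ico _ (show i + 1 ≤ n by omega), Finset.sum_range_succ] at hc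
  have hR : ∑ k ∈ Finset.Ico (j + 1) m, x i k <
      ∑ k ∈ Finset.Ico (j + 1) m, (c k - ∑ l ∈ Finset.range i, x l k) := by
    refine Finset.sum_lt_sum_of_nonempty (Finset.nonempty_Ico.2 (by omega)) fun k hk => ?_
    have hkm := (Finset.mem_Ico.1 hk).2
    have hck := hcol k hkm
    rw [← Finset.sum_range_add_sum_Ico _ (show i + 1 ≤ n by omega),
      Finset.sum_range_succ] at hck
    have : 0 < ∑ l ∈ Finset.Ico (i + 1) n, x l k :=
      Finset.sum_pos (fun l hl => hpos l (Finset.mem_Ico.1 hl).2 k hkm)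
        (Finset.nonempty_Ico.2 (by omega))
    linarith
  have hC : ∑ l ∈ Finset.Ico (i + 1) n, x l j < ∑ l ∈ Finset.Ico (i + 1) n, r l := by
    refine Finset.sum_lt_sum_of_nonempty (Finset.nonempty_Ico.2 (by omega)) fun l hl => ?_
    have hln := (Finset.mem_Ico.1 hl).2
    rw [← hrow l hln]
    exact Finset.single_lt_sum (i := j) (j := m - 1) (f := fun k => x l k) (by omega)
      (Finset.mem_range.2 (by omega)) (Finset.mem_range.2 (by omega))
      (hpos l hln _ (by omega)) fun k hk _ => (hpos l hln k (Finset.mem_range.1 hk)).le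
  exact max_lt (hpos i (by omega) j (by omega)) (max_lt (by linarith) (by linarith))

end Margins

lemma extFin_val {n : ℕ} (r : Fin n → ℝ) (i : Fin n) : extFin r i = r i := by
  simp [extFin]

lemma extFin2_val {n m : ℕ} (t : Fin n → Fin m → ℝ) (i : Fin n) (j : Fin m) :
    extFin2 t i j = t i j := by
  simp [extFin2]

/-- For `n, m ≥ 2` and strictly positive margins with equal total
sums, every matrix of `T(r,c)` all of whose entries are strictly positive is the TBP
image of a unique parameter array `t ∈ ℝ^{(n-1)×(m-1)}`. -/
theorem tbp_surjective_unique (n m : ℕ) (hn : 2 ≤ n) (hm : 2 ≤ m)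
    (r : Fin n → ℝ) (c : Fin m → ℝ)
    (hr : ∀ i, 0 < r i) (hc : ∀ j, 0 < c j)
    (hbal : ∑ i, r i = ∑ j, c j)
    (X : Matrix (Fin n) (Fin m) ℝ)
    (hX : X ∈ transportPolytope n m r c)
    (hXpos : ∀ i j, 0 < X i j) :
    ∃! t : Fin (n - 1) → Fin (m - 1) → ℝ, tbpMap n m r c t = X := by
  obtain ⟨-, hXr, hXc⟩ := hX
  have hrow : ∀ i < n, ∑ k ∈ Finset.range m, extFin2 X i k = extFin r i := by
    intro i hi
    lift i to Fin n using hi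
    rw [Finset.sum_range, extFin_val, ← hXr i]
    exact Finset.sum_congr rfl fun k _ => extFin2_val X i k
  have hcol : ∀ j < m, ∑ k ∈ Finset.range n, extFin2 X k j = extFin c j := by
    intro j hj
    lift j to Fin m using hj
    rw [Finset.sum_range, extFin_val, ← hXc j]
    exact Finset.sum_congr rfl fun k _ => extFin2_val X k j
  have hpos : ∀ i < n, ∀ j < m, 0 < extFin2 X i j := by
    intro i hi j hj
    lift i to Fin n using hi
    lift j to Fin m using hj
    exact (hXpos i j).trans_eq (extFin2_val X i j).symm
  have key (t : Fin (n - 1) → Fin (m - 1) → ℝ) : tbpMap n m r c t = X ↔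
      ∀ (i : Fin (n - 1)) (j : Fin (m - 1)),
        tbpLower n m (extFin r) (extFin c) (extFin2 X) i j +
        (tbpUpper (extFin r) (extFin c) (extFin2 X) i j -
          tbpLower n m (extFin r) (extFin c) (extFin2 X) i j) * sigmoid (t i j) =
        extFin2 X i j := by
    have h := tbpEntry_eqOn_iff hrow hcol (extFin2 t)
    simpa +contextual [Fin.forall_iff, ← Matrix.ext_iff, tbpMap, extFin2] using h
  have hlow (i : Fin (n - 1)) (j : Fin (m - 1)) := tbpLower_lt hrow hcol hpos i.2 j.2
  have hupp (i : Fin (n - 1)) (j : Fin (m - 1)) := lt_tbpUpper hrow hcol hpos i.2 j.2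
  have hex (i : Fin (n - 1)) (j : Fin (m - 1)) :
      ∃ s, sigmoid s =
        (extFin2 X i j - tbpLower n m (extFin r) (extFin c) (extFin2 X) i j) /
          (tbpUpper (extFin r) (extFin c) (extFin2 X) i j -
            tbpLower n m (extFin r) (extFin c) (extFin2 X) i j) := by
    have h1 := hlow i j
    have h2 := hupp i j
    exact exists_sigmoid_eq (div_pos (by linarith) (by linarith))
      ((div_lt_one (by linarith)).2 (by linarith))
  choose t ht using hex
  have hne (i : Fin (n - 1)) (j : Fin (m - 1)) :
      tbpUpper (extFin r) (extFin c) (extFin2 X) i j -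
        tbpLower n m (extFin r) (extFin c) (extFin2 X) i j ≠ 0 :=
    (sub_pos.2 ((hlow i j).trans (hupp i j))).ne'
  have ht_sol : tbpMap n m r c t = X := (key t).2 fun i j => by
    rw [ht, mul_div_cancel₀ _ (hne i j)]
    ring
  refine ⟨t, ht_sol, fun s hs => ?_⟩
  funext i j
  have e := ((key s).1 hs i j).trans ((key t).1 ht_sol i j).symm
  exact sigmoid_strictMono.injective (mul_left_cancel₀ (hne i j) (add_left_cancel e))
end

section
/- Let r ∈ ℝ^n and c ∈ ℝ^m have strictly positive entries and equal total sums M. Then r₁ − Σ_{k=2}^{m} c_k = c₁ − Σ_{k=2}^{n} r_k = r₁ + c₁ − M, and the set of possible (1,1)-entries of matrices in the transportation polytope, {X₁₁ : X ∈ T(r,c)}, is exactly the closed interval [max(0, r₁ + c₁ − M), min(r₁, c₁)]. -/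
/-- Normalized weights supported off `a`, proportional to a nonnegative `w`. If the mass of `w`
off `a` vanishes then so do the weights, hence the guarded form of the total-mass identity. -/
lemma exists_weights_off {ι : Type*} [Fintype ι] [DecidableEq ι] (w : ι → ℝ)
    (hw : ∀ i, 0 ≤ w i) (a : ι) :
    ∃ p : ι → ℝ, (∀ i, 0 ≤ p i) ∧ p a = 0 ∧
      (∀ i, w a * (if i = a then 1 else 0) + (∑ k, w k - w a) * p i = w i) ∧
      ∀ t, 0 ≤ t → t ≤ ∑ k, w k - w a → t * ∑ i, p i = t := by
  have hS : ∑ k, w k - w a = ∑ k ∈ Finset.univ.erase a, w k := by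
    rw [← Finset.add_sum_erase _ w (Finset.mem_univ a)]; ring
  have hS0 : 0 ≤ ∑ k, w k - w a := hS ▸ Finset.sum_nonneg fun i _ => hw i
  refine ⟨fun i => if i = a then 0 else w i / (∑ k, w k - w a), fun i => ?_, if_pos rfl,
    fun i => ?_, fun t ht htS => ?_⟩
  · dsimp only
    split_ifs
    · exact le_rfl
    · exact div_nonneg (hw i) hS0
  · by_cases h : i = a
    · simp [h]
    · have hle : w i ≤ ∑ k, w k - w a :=
        hS ▸ Finset.single_le_sum (fun k _ => hw k) (Finset.mem_erase.2 ⟨h, Finset.mem_univ i⟩)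
      simp only [h, if_false, mul_zero, zero_add]
      rcases hS0.eq_or_lt with h0 | h0
      · have : w i = 0 := le_antisymm (h0 ▸ hle) (hw i)
        simp [this]
      · exact mul_div_cancel₀ _ h0.ne'
  · rcases hS0.eq_or_lt with h0 | h0
    · have : t = 0 := le_antisymm (h0 ▸ htS) ht
      simp [this]
    · rw [← Finset.add_sum_erase _ _ (Finset.mem_univ a), if_pos rfl, zero_add,
        Finset.sum_congr rfl fun i hi => if_neg (Finset.ne_of_mem_erase hi), ← Finset.sum_div,
        ← hS, div_self h0.ne', mul_one]

/-- For strictly positive margins `r ∈ ℝⁿ`, `c ∈ ℝᵐ` with equal total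
sums `M`, one has `r₁ − Σ_{k≥2} c_k = c₁ − Σ_{k≥2} r_k = r₁ + c₁ − M`, and the set of
possible `(1,1)`-entries of matrices of `T(r,c)` is exactly the closed interval
`[max(0, r₁ + c₁ − M), min(r₁, c₁)]`. -/
theorem tbp_corner_entry_range (n m : ℕ) (hn : 0 < n) (hm : 0 < m)
    (r : Fin n → ℝ) (c : Fin m → ℝ)
    (hr : ∀ i, 0 < r i) (hc : ∀ j, 0 < c j)
    (M : ℝ) (hMr : ∑ i, r i = M) (hMc : ∑ j, c j = M) :
    (r ⟨0, hn⟩ - ∑ k ∈ Finset.univ.erase ⟨0, hm⟩, c k =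
      c ⟨0, hm⟩ - ∑ k ∈ Finset.univ.erase ⟨0, hn⟩, r k) ∧
    (r ⟨0, hn⟩ - ∑ k ∈ Finset.univ.erase ⟨0, hm⟩, c k =
      r ⟨0, hn⟩ + c ⟨0, hm⟩ - M) ∧
    {x : ℝ | ∃ X ∈ transportPolytope n m r c, X ⟨0, hn⟩ ⟨0, hm⟩ = x} =
      Set.Icc (max 0 (r ⟨0, hn⟩ + c ⟨0, hm⟩ - M)) (min (r ⟨0, hn⟩) (c ⟨0, hm⟩)) := by
  have hR := Finset.add_sum_erase _ r (Finset.mem_univ ⟨0, hn⟩)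
  have hC := Finset.add_sum_erase _ c (Finset.mem_univ ⟨0, hm⟩)
  refine ⟨by linarith, by linarith, Set.ext fun x => ⟨?_, ?_⟩⟩
  · rintro ⟨X, ⟨hX, hrow, hcol⟩, rfl⟩
    have hle : ∀ i j, X i j ≤ r i := fun i j =>
      hrow i ▸ Finset.single_le_sum (fun k _ => hX i k) (Finset.mem_univ j)
    have hcorner := Finset.add_sum_erase _ (fun i => X i ⟨0, hm⟩) (Finset.mem_univ ⟨0, hn⟩)
    have hoff : ∑ i ∈ Finset.univ.erase ⟨0, hn⟩, X i ⟨0, hm⟩ ≤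
        ∑ i ∈ Finset.univ.erase ⟨0, hn⟩, r i := Finset.sum_le_sum fun i _ => hle i _
    have hcol0 := hcol ⟨0, hm⟩
    refine ⟨max_le (hX _ _) (by linarith), le_min (hle _ _) ?_⟩
    exact hcol0 ▸ Finset.single_le_sum (f := fun i => X i ⟨0, hm⟩) (fun k _ => hX k _)
      (Finset.mem_univ _)
  · rintro ⟨hlow, hupp⟩
    obtain ⟨hx0, hxM⟩ := max_le_iff.1 hlow
    obtain ⟨hxr, hxc⟩ := le_min_iff.1 hupp
    obtain ⟨p, hp, hp0, hpr, hpt⟩ := exists_weights_off r (fun i => (hr i).le) ⟨0, hn⟩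
    obtain ⟨q, hq, hq0, hqc, hqt⟩ := exists_weights_off c (fun j => (hc j).le) ⟨0, hm⟩
    rw [hMr] at hpr hpt
    rw [hMc] at hqc hqt
    generalize hi₀ : (⟨0, hn⟩ : Fin n) = i₀ at *
    generalize hj₀ : (⟨0, hm⟩ : Fin m) = j₀ at *
    set e : Fin n → ℝ := fun i => if i = i₀ then 1 else 0 with he
    set f : Fin m → ℝ := fun j => if j = j₀ then 1 else 0 with hf
    have he0 : ∀ i, 0 ≤ e i := fun i => by simp only [he]; split_ifs <;> norm_num
    have hf0 : ∀ j, 0 ≤ f j := fun j => by simp only [hf]; split_ifs <;> norm_num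
    have hes : ∑ i, e i = 1 := by simp [he]
    have hfs : ∑ j, f j = 1 := by simp [hf]
    set s := M - r i₀ - c j₀ + x with hs
    have hs0 : 0 ≤ s := by linarith
    refine ⟨fun i j => x * e i * f j + (r i₀ - x) * e i * q j + (c j₀ - x) * p i * f j +
      s * p i * q j, ⟨fun i j => ?_, fun i => ?_, fun j => ?_⟩, ?_⟩
    · have := sub_nonneg.2 hxr
      have := sub_nonneg.2 hxc
      have := he0 i
      have := hf0 j
      have := hp i
      have := hq j
      positivity
    · simp only [Finset.sum_add_distrib, ← Finset.mul_sum, hfs]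
      have h1 := hqt (r i₀ - x) (by linarith) (by linarith)
      have h2 := hqt s hs0 (by linarith)
      linear_combination e i * h1 + p i * h2 + hpr i
    · simp only [Finset.sum_add_distrib, ← Finset.mul_sum, ← Finset.sum_mul, hes]
      have h1 := hpt (c j₀ - x) (by linarith) (by linarith)
      have h2 := hpt s hs0 (by linarith)
      linear_combination f j * h1 + q j * h2 + hqc j
    · simp [he, hf, hp0, hq0]
end

section
/- Let D be a function assigning a natural number to every pair of positive integers, such that D(1,m) = 0 and D(n,1) = 0 for all n, m ≥ 1, and such that for every n, m ≥ 2 there exist positive integers n₁, n₂, m₁, m₂ with n₁ + n₂ = n and m₁ + m₂ = m for which D(n,m) = (n + m − 3) + D(n₁,m₁) + D(n₁,m₂) + D(n₂,m₁) + D(n₂,m₂). Then D(n,m) = (n−1)(m−1) for all positive integers n, m. -/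
/-- If `D` assigns a natural number to every pair of positive
integers, with `D(1,m) = D(n,1) = 0`, and for every `n, m ≥ 2` there is a split
`n = n₁ + n₂`, `m = m₁ + m₂` into positive parts with
`D(n,m) = (n + m − 3) + D(n₁,m₁) + D(n₁,m₂) + D(n₂,m₁) + D(n₂,m₂)`,
then `D(n,m) = (n−1)(m−1)` for all positive `n, m`. -/
theorem rtbp_parameter_count (D : ℕ → ℕ → ℕ)
    (h1 : ∀ m, 1 ≤ m → D 1 m = 0)
    (h2 : ∀ n, 1 ≤ n → D n 1 = 0)
    (hrec : ∀ n m, 2 ≤ n → 2 ≤ m → ∃ n₁ n₂ m₁ m₂ : ℕ,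
      0 < n₁ ∧ 0 < n₂ ∧ 0 < m₁ ∧ 0 < m₂ ∧ n₁ + n₂ = n ∧ m₁ + m₂ = m ∧
      D n m = (n + m - 3) + D n₁ m₁ + D n₁ m₂ + D n₂ m₁ + D n₂ m₂) :
    ∀ n m, 1 ≤ n → 1 ≤ m → D n m = (n - 1) * (m - 1) := by
  intro n
  induction n using Nat.strong_induction_on with
  | _ n ih =>
    intro m hn hm
    rcases hn.eq_or_lt with rfl | hn
    · simp [h1 m hm]
    rcases hm.eq_or_lt with rfl | hm
    · simp [h2 n hn.le]
    obtain ⟨a, b, c, d, ha, hb, hc, hd, rfl, rfl, h⟩ := hrec n m hn hm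
    rw [h, ih a (by omega) c ha hc, ih a (by omega) d ha hd,
      ih b (by omega) c hb hc, ih b (by omega) d hb hd]
    obtain ⟨a, rfl⟩ := Nat.exists_eq_add_of_lt ha
    obtain ⟨b, rfl⟩ := Nat.exists_eq_add_of_lt hb
    obtain ⟨c, rfl⟩ := Nat.exists_eq_add_of_lt hc
    obtain ⟨d, rfl⟩ := Nat.exists_eq_add_of_lt hd
    have hrows : 0 + a + 1 + (0 + b + 1) - 1 = a + b + 1 := by omega
    have hcols : 0 + c + 1 + (0 + d + 1) - 1 = c + d + 1 := by omega
    have hsplit : 0 + a + 1 + (0 + b + 1) + (0 + c + 1 + (0 + d + 1)) - 3 =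
        a + b + c + d + 1 := by omega
    rw [hrows, hcols, hsplit]
    simp only [Nat.add_sub_cancel, zero_add]
    ring
end

section
/- Let r ∈ ℝ^n and c ∈ ℝ^m have strictly positive entries and equal total sums. Then the transportation polytope T(r,c), viewed as a subset of the space of real n×m matrices, has affine dimension (n−1)(m−1); that is, the direction space of the affine span of T(r,c) has dimension (n−1)(m−1). -/
/-- The matrices all of whose row sums and column sums vanish. -/
def zeroMarginSubmodule (n m : ℕ) : Submodule ℝ (Matrix (Fin n) (Fin m) ℝ) where
  carrier := {X | (∀ i, ∑ j, X i j = 0) ∧ (∀ j, ∑ i, X i j = 0)}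
  zero_mem' := by simp
  add_mem' := by
    rintro X Y ⟨hX, hX'⟩ ⟨hY, hY'⟩
    constructor <;> intro k <;> simp [Finset.sum_add_distrib, *]
  smul_mem' := by
    rintro t X ⟨hX, hX'⟩
    constructor <;> intro k <;> simp [← Finset.mul_sum, *]

/-- A matrix with vanishing margins is determined by the entries outside its first row and
column, and these are arbitrary. -/
noncomputable def zeroMarginEquiv (a b : ℕ) :
    zeroMarginSubmodule (a + 1) (b + 1) ≃ₗ[ℝ] Matrix (Fin a) (Fin b) ℝ :=
  LinearEquiv.ofBijective
    { toFun := fun X => Matrix.of fun i j => X.1 i.succ j.succ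
      map_add' := fun _ _ => rfl
      map_smul' := fun _ _ => rfl } <| by
    constructor
    · rw [injective_iff_map_eq_zero]
      rintro ⟨X, hrow, hcol⟩ h
      have hss : ∀ i j, X (Fin.succ i) (Fin.succ j) = 0 := fun i j => congrFun (congrFun h i) j
      have hs0 : ∀ i, X (Fin.succ i) 0 = 0 := fun i => by
        simpa [Fin.sum_univ_succ, hss] using hrow i.succ
      have h0 : ∀ j, X 0 j = 0 := fun j => by
        have := hcol j
        refine Fin.cases (fun this => ?_) (fun k this => ?_) j this
        · simpa [Fin.sum_univ_succ, hs0] using this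
        · simpa [Fin.sum_univ_succ, hss] using this
      ext i j
      refine Fin.cases (h0 j) (fun i => ?_) i
      exact Fin.cases (hs0 i) (fun j => hss i j) j
    · intro Y
      refine ⟨⟨Matrix.of fun i j => Fin.cases
        (Fin.cases (∑ k, ∑ l, Y k l) (fun l => -∑ k, Y k l) j)
        (fun k => Fin.cases (-∑ l, Y k l) (fun l => Y k l) j) i, ?_, ?_⟩, ?_⟩
      · intro i
        refine Fin.cases ?_ (fun k => ?_) i
        · simp [Fin.sum_univ_succ, Finset.sum_comm (f := fun k l => Y k l)]
        · simp [Fin.sum_univ_succ]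
      · intro j
        refine Fin.cases ?_ (fun l => ?_) j <;> simp [Fin.sum_univ_succ]
      · ext i j
        rfl

theorem finrank_zeroMarginSubmodule {n m : ℕ} (hn : 0 < n) (hm : 0 < m) :
    Module.finrank ℝ (zeroMarginSubmodule n m) = (n - 1) * (m - 1) := by
  obtain ⟨a, rfl⟩ := Nat.exists_eq_add_one.mpr hn
  obtain ⟨b, rfl⟩ := Nat.exists_eq_add_one.mpr hm
  rw [(zeroMarginEquiv a b).finrank_eq, Module.finrank_matrix]
  simp

theorem exists_pos_mem_transportPolytope {n m : ℕ} (hn : 0 < n)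
    {r : Fin n → ℝ} {c : Fin m → ℝ} (hr : ∀ i, 0 < r i) (hc : ∀ j, 0 < c j)
    (hbal : ∑ i, r i = ∑ j, c j) :
    ∃ X ∈ transportPolytope n m r c, ∀ i j, 0 < X i j := by
  have hS : 0 < ∑ i, r i := Finset.sum_pos (fun i _ => hr i) ⟨⟨0, hn⟩, Finset.mem_univ _⟩
  have hpos : ∀ i j, 0 < r i * c j / ∑ k, r k := fun i j =>
    div_pos (mul_pos (hr i) (hc j)) hS
  refine ⟨Matrix.of fun i j => r i * c j / ∑ k, r k,
    ⟨fun i j => (hpos i j).le, fun i => ?_, fun j => ?_⟩, hpos⟩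
  · simp only [Matrix.of_apply]
    rw [← Finset.sum_div, ← Finset.mul_sum, ← hbal, mul_div_cancel_right₀ _ hS.ne']
  · simp only [Matrix.of_apply]
    rw [← Finset.sum_div, ← Finset.sum_mul, mul_div_cancel_left₀ _ hS.ne']

theorem direction_affineSpan_transportPolytope {n m : ℕ} {r : Fin n → ℝ} {c : Fin m → ℝ}
    (h : ∃ X ∈ transportPolytope n m r c, ∀ i j, 0 < X i j) :
    (affineSpan ℝ (transportPolytope n m r c)).direction = zeroMarginSubmodule n m := by
  rw [direction_affineSpan]
  apply le_antisymm
  · rw [vectorSpan_def, Submodule.span_le]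
    rintro _ ⟨X, ⟨-, hX, hX'⟩, Y, ⟨-, hY, hY'⟩, rfl⟩
    constructor <;> intro k <;> simp [Finset.sum_sub_distrib, *]
  · rintro D ⟨hrow, hcol⟩
    obtain ⟨X, hX, hpos⟩ := h
    have hev : ∀ᶠ t : ℝ in nhds 0, ∀ i j, 0 < X i j + t * D i j := by
      simp only [Filter.eventually_all]
      intro i j
      have hcont : Continuous fun t : ℝ => X i j + t * D i j := by fun_prop
      exact hcont.continuousAt.eventually (lt_mem_nhds (by simpa using hpos i j))
    obtain ⟨t, ht, ht0⟩ := ((hev.filter_mono nhdsWithin_le_nhds).and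
      (self_mem_nhdsWithin : Set.Ioi (0 : ℝ) ∈ nhdsWithin 0 (Set.Ioi 0))).exists
    have hmem : X + t • D ∈ transportPolytope n m r c := by
      refine ⟨fun i j => (ht i j).le, fun i => ?_, fun j => ?_⟩
      · simp [Finset.sum_add_distrib, ← Finset.mul_sum, hrow, hX.2.1]
      · simp [Finset.sum_add_distrib, ← Finset.mul_sum, hcol, hX.2.2]
    have hsub := vsub_mem_vectorSpan ℝ hmem hX
    rw [vsub_eq_sub, add_sub_cancel_left] at hsub
    exact (Submodule.smul_mem_iff _ (ne_of_gt ht0)).mp hsub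

/-- For strictly positive margins `r ∈ ℝⁿ`, `c ∈ ℝᵐ` with equal total
sums, the transportation polytope `T(r,c)` has affine dimension `(n−1)(m−1)`: the
direction space of its affine span has dimension `(n−1)(m−1)`. -/
theorem transport_polytope_affine_dimension (n m : ℕ) (hn : 0 < n) (hm : 0 < m)
    (r : Fin n → ℝ) (c : Fin m → ℝ)
    (hr : ∀ i, 0 < r i) (hc : ∀ j, 0 < c j)
    (hbal : ∑ i, r i = ∑ j, c j) :
    Module.finrank ℝ (affineSpan ℝ (transportPolytope n m r c)).direction =
      (n - 1) * (m - 1) := by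
  rw [direction_affineSpan_transportPolytope (exists_pos_mem_transportPolytope hn hr hc hbal),
    finrank_zeroMarginSubmodule hn hm]
end
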